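/- Let (Ω, F, P) be a probability space, G ⊆ F a sub-σ-algebra, and n ≥ 1. Let ξ_1, …, ξ_n be i.i.d. standard Gaussian random variables independent of G, and let σ_1, …, σ_n be G-measurable real random variables with σ_l² ≤ σ_* almost surely for a constant σ_* > 0. Let b − a > 0 and let (c_{j,l})_{1 ≤ j,l ≤ n} be real numbers satisfying the orthonormality relations Σ_{l=1}^n c_{i,l} c_{j,l} = (n/(b−a)) δ_{ij} for all 1 ≤ i, j ≤ n. Define ξ_{j,n} = (1/√n) Σ_{l=1}^n σ_l ξ_l c_{j,l}. Then for any real numbers v_1, …, v_n, with V_n = Σ_{j=1}^n v_j²: E(Σ_{j=1}^n v_j ξ_{j,n})² ≤ (σ_*/(b−a)) V_n and E(Σ_{j=1}^n v_j ξ_{j,n})⁴ ≤ (3σ_*²/(b−a)²) V_n². -/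

import Mathlib

open MeasureTheory ProbabilityTheory

open scoped NNReal ENNReal

lemma iteratedDeriv_succ_exp_half_sq {f g h : ℝ → ℝ} {v : ℝ} {k : ℕ}
    (hf : iteratedDeriv k (fun t ↦ Real.exp (v * t ^ 2 / 2)) =
      fun t ↦ f t * Real.exp (v * t ^ 2 / 2))
    (hg : ∀ t, HasDerivAt f (g t) t) (hh : ∀ t, h t = g t + v * t * f t) :
    iteratedDeriv (k + 1) (fun t ↦ Real.exp (v * t ^ 2 / 2)) =
      fun t ↦ h t * Real.exp (v * t ^ 2 / 2) := by
  ext t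
  have he : HasDerivAt (fun t : ℝ ↦ v * t ^ 2 / 2) (v * t) t :=
    ((((hasDerivAt_id' t).fun_pow 2).const_mul v).div_const 2).congr_deriv (by push_cast; ring)
  rw [iteratedDeriv_succ, hf, ((hg t).fun_mul he.exp).deriv, hh]
  ring

lemma integral_pow_gaussianReal_zero_eq_iteratedDeriv (v : ℝ≥0) (k : ℕ) :
    ∫ x, x ^ k ∂gaussianReal 0 v = iteratedDeriv k (fun t ↦ Real.exp (v * t ^ 2 / 2)) 0 := by
  have h := iteratedDeriv_mgf_zero (X := id) (μ := gaussianReal 0 v) (by simp) k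
  rw [mgf_id_gaussianReal] at h
  simpa using h.symm

lemma integral_pow_two_gaussianReal_zero (v : ℝ≥0) :
    ∫ x, x ^ 2 ∂gaussianReal 0 v = v := by
  have h := variance_fun_id_gaussianReal (μ := 0) (v := v)
  rwa [variance_of_integral_eq_zero (by fun_prop) (by simp)] at h

lemma integral_pow_four_gaussianReal_zero (v : ℝ≥0) :
    ∫ x, x ^ 4 ∂gaussianReal 0 v = 3 * (v : ℝ) ^ 2 := by
  have hid (t : ℝ) := hasDerivAt_id' t
  have h0 : iteratedDeriv 0 (fun t ↦ Real.exp (v * t ^ 2 / 2)) =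
      fun t ↦ 1 * Real.exp (v * t ^ 2 / 2) := by simp
  have h1 := iteratedDeriv_succ_exp_half_sq (h := fun t ↦ v * t) h0
    (fun t ↦ hasDerivAt_const t 1) (fun t ↦ by ring)
  have h2 := iteratedDeriv_succ_exp_half_sq (h := fun t ↦ v + v ^ 2 * t ^ 2) h1
    (fun t ↦ (hid t).const_mul _) (fun t ↦ by ring)
  have h3 := iteratedDeriv_succ_exp_half_sq (h := fun t ↦ 3 * v ^ 2 * t + v ^ 3 * t ^ 3) h2
    (fun t ↦ (((hid t).fun_pow 2).const_mul _).const_add _) (fun t ↦ by push_cast; ring)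
  have h4 := iteratedDeriv_succ_exp_half_sq
    (h := fun t ↦ 3 * v ^ 2 + 6 * v ^ 3 * t ^ 2 + v ^ 4 * t ^ 4) h3
    (fun t ↦ ((hid t).const_mul _).fun_add (((hid t).fun_pow 3).const_mul _))
    (fun t ↦ by push_cast; ring)
  rw [integral_pow_gaussianReal_zero_eq_iteratedDeriv, h4]
  simp

section LinearCombination

variable {Ω ι : Type*} [Fintype ι] {m0 : MeasurableSpace Ω} {P : Measure Ω}
  {ξ : ι → Ω → ℝ}

lemma hasLaw_sum_const_mul_gaussianReal (hξ : ∀ l, HasLaw (ξ l) (gaussianReal 0 1) P)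
    (hind : iIndepFun ξ P) (u : ι → ℝ) :
    HasLaw (fun ω ↦ ∑ l, u l * ξ l ω) (gaussianReal 0 (∑ l, u l ^ 2).toNNReal) P := by
  have := hind.isProbabilityMeasure
  have hlaw (l : ι) := gaussianReal_const_mul (hξ l) (u l)
  have hg (l : ι) : HasGaussianLaw (fun ω ↦ u l * ξ l ω) P := (hlaw l).hasGaussianLaw
  have hind' : iIndepFun (fun l ω ↦ u l * ξ l ω) P :=
    hind.comp (fun l x ↦ u l * x) fun l ↦ by fun_prop
  have hsum := hind'.hasGaussianLaw_fun_sum hg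
  refine ⟨hsum.aemeasurable, ?_⟩
  have hmean : ∫ ω, ∑ l, u l * ξ l ω ∂P = 0 := by
    rw [integral_finsetSum _ fun l _ ↦ (hg l).integrable]
    refine Finset.sum_eq_zero fun l _ ↦ ?_
    rw [(hlaw l).integral_eq]
    simp
  have hvar : Var[fun ω ↦ ∑ l, u l * ξ l ω; P] = ∑ l, u l ^ 2 := by
    have h := IndepFun.variance_sum (μ := P) (X := fun l ω ↦ u l * ξ l ω) (s := Finset.univ)
      (fun l _ ↦ (hg l).memLp_two) (fun i _ j _ hij ↦ hind'.indepFun hij)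
    have he : (∑ l, fun ω ↦ u l * ξ l ω) = fun ω ↦ ∑ l, u l * ξ l ω := by
      ext ω; simp
    rw [he] at h
    rw [h]
    refine Finset.sum_congr rfl fun l _ ↦ ?_
    rw [(hlaw l).variance_eq]
    simp
  rw [hsum.map_eq_gaussianReal, hmean, hvar]

lemma lintegral_comp_le_of_indepFun {α β : Type*} [MeasurableSpace α] [MeasurableSpace β]
    [IsProbabilityMeasure P] {S : Ω → α} {X : Ω → β} (hS : Measurable S) (hX : Measurable X)
    (hSX : IndepFun S X P) {F : α → β → ℝ≥0∞} (hF : Measurable (Function.uncurry F)) {K : ℝ≥0∞}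
    (hK : ∀ᵐ ω ∂P, ∫⁻ ω', F (S ω) (X ω') ∂P ≤ K) :
    ∫⁻ ω, F (S ω) (X ω) ∂P ≤ K := by
  have : IsProbabilityMeasure (P.map X) := Measure.isProbabilityMeasure_map hX.aemeasurable
  have hmap := (indepFun_iff_map_prod_eq_prod_map_map hS.aemeasurable hX.aemeasurable).1 hSX
  calc ∫⁻ ω, F (S ω) (X ω) ∂P
      = ∫⁻ p, Function.uncurry F p ∂(P.map fun ω ↦ (S ω, X ω)) :=
        (lintegral_map hF (hS.prodMk hX)).symm
    _ = ∫⁻ s, ∫⁻ x, F s x ∂(P.map X) ∂(P.map S) := by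
        rw [hmap, lintegral_prod _ hF.aemeasurable]; rfl
    _ = ∫⁻ ω, ∫⁻ x, F (S ω) x ∂(P.map X) ∂P := lintegral_map hF.lintegral_prod_right' hS
    _ = ∫⁻ ω, ∫⁻ ω', F (S ω) (X ω') ∂P ∂P := by
        refine lintegral_congr fun ω ↦ ?_
        exact lintegral_map (hF.comp measurable_prodMk_left) hX
    _ ≤ ∫⁻ _, K ∂P := lintegral_mono_ae hK
    _ = K := by simp

lemma integral_pow_sum_mul_le [IsProbabilityMeasure P] {σ : ι → Ω → ℝ}
    (hσ : ∀ l, Measurable (σ l)) (hξm : ∀ l, Measurable (ξ l))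
    (hξ : ∀ l, HasLaw (ξ l) (gaussianReal 0 1) P) (hind : iIndepFun ξ P)
    (hσξ : IndepFun (fun ω l ↦ σ l ω) (fun ω l ↦ ξ l ω) P)
    (w : ι → ℝ) {k : ℕ} (hk : Even k) {K : ℝ} (hK0 : 0 ≤ K)
    (hK : ∀ᵐ ω ∂P, ∫ x, x ^ k ∂gaussianReal 0 (∑ l, (w l * σ l ω) ^ 2).toNNReal ≤ K) :
    ∫ ω, (∑ l, w l * σ l ω * ξ l ω) ^ k ∂P ≤ K := by
  rw [integral_eq_lintegral_of_nonneg_ae (ae_of_all _ fun ω ↦ hk.pow_nonneg _)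
    (Measurable.aestronglyMeasurable (by fun_prop))]
  refine ENNReal.toReal_le_of_le_ofReal hK0 ?_
  refine lintegral_comp_le_of_indepFun (S := fun ω l ↦ σ l ω) (X := fun ω l ↦ ξ l ω)
    (F := fun s x ↦ ENNReal.ofReal ((∑ l, w l * s l * x l) ^ k))
    (by fun_prop) (by fun_prop) hσξ ?_ ?_
  · unfold Function.uncurry
    fun_prop
  · filter_upwards [hK] with ω hω
    have hlaw := hasLaw_sum_const_mul_gaussianReal hξ hind fun l ↦ w l * σ l ω
    have hint : Integrable (fun ω' ↦ (∑ l, w l * σ l ω * ξ l ω') ^ k) P := by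
      have h := (hlaw.hasGaussianLaw.memLp (p := k) (by simp)).integrable_norm_pow'
      simpa [← abs_pow, hk.pow_abs] using h
    rw [← ofReal_integral_eq_lintegral_ofReal hint (ae_of_all _ fun ω ↦ hk.pow_nonneg _)]
    refine ENNReal.ofReal_le_ofReal (le_of_eq_of_le ?_ hω)
    exact hlaw.integral_comp (f := fun x ↦ x ^ k) (by fun_prop)

end LinearCombination

lemma sum_sq_sum_mul_of_orthogonal {ι κ : Type*} [Fintype ι] [Fintype κ] [DecidableEq ι]
    {c : ι → κ → ℝ} {r : ℝ}
    (hc : ∀ i j, ∑ l, c i l * c j l = r * (if i = j then 1 else 0)) (v : ι → ℝ) :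
    ∑ l, (∑ j, v j * c j l) ^ 2 = r * ∑ j, v j ^ 2 := by
  calc ∑ l, (∑ j, v j * c j l) ^ 2
      = ∑ l, ∑ i, ∑ j, v i * v j * (c i l * c j l) := by
        refine Finset.sum_congr rfl fun l _ ↦ ?_
        rw [sq, Finset.sum_mul_sum]
        exact Finset.sum_congr rfl fun i _ ↦ Finset.sum_congr rfl fun j _ ↦ by ring
    _ = ∑ i, ∑ j, v i * v j * ∑ l, c i l * c j l := by
        rw [Finset.sum_comm]
        refine Finset.sum_congr rfl fun i _ ↦ ?_
        rw [Finset.sum_comm]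
        simp_rw [Finset.mul_sum]
    _ = r * ∑ j, v j ^ 2 := by
        simp only [hc, mul_ite, mul_one, mul_zero, Finset.sum_ite_eq, Finset.mem_univ, if_true,
          Finset.mul_sum]
        exact Finset.sum_congr rfl fun i _ ↦ by ring

/-- moment bounds for `ξ_{j,n} = n^{-1/2} Σ_l σ_l ξ_l c_{j,l}` built from
i.i.d. standard Gaussians `ξ_l` independent of a sub-σ-algebra `G`, `G`-measurable
coefficients `σ_l` with `σ_l² ≤ σ_*` a.s., and discretely orthonormal coefficients
`c_{j,l}`: for all reals `v_j`,
`E(Σ_j v_j ξ_{j,n})² ≤ (σ_*/(b−a)) V_n` and `E(Σ_j v_j ξ_{j,n})⁴ ≤ 3σ_*²/(b−a)² V_n²`. -/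
theorem stmt10 {Ω : Type*} [m0 : MeasurableSpace Ω] (P : Measure Ω) [IsProbabilityMeasure P]
    (G : MeasurableSpace Ω) (hG : G ≤ m0)
    (n : ℕ) (hn : 1 ≤ n)
    (ξ : Fin n → Ω → ℝ)
    (hξmeas : ∀ l, @Measurable Ω ℝ m0 _ (ξ l))
    (hgauss : ∀ l, @Measure.map Ω ℝ m0 _ (ξ l) P = gaussianReal 0 1)
    (hiid : iIndepFun ξ P)
    (hindepG : Indep (⨆ l, MeasurableSpace.comap (ξ l) Real.measurableSpace) G P)
    (σs : Fin n → Ω → ℝ)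
    (hσmeas : ∀ l, @Measurable Ω ℝ G _ (σs l))
    (σstar : ℝ) (hσstar : 0 < σstar)
    (hσbd : ∀ l, ∀ᵐ ω ∂P, (σs l ω) ^ 2 ≤ σstar)
    (a b : ℝ) (hab : 0 < b - a)
    (c : Fin n → Fin n → ℝ)
    (horth : ∀ i j, ∑ l, c i l * c j l = ((n : ℝ) / (b - a)) * (if i = j then 1 else 0))
    (v : Fin n → ℝ) :
    (∫ ω, (∑ j, v j * ((1 / Real.sqrt n) * ∑ l, σs l ω * ξ l ω * c j l)) ^ 2 ∂P
        ≤ σstar / (b - a) * ∑ j, (v j) ^ 2) ∧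
    (∫ ω, (∑ j, v j * ((1 / Real.sqrt n) * ∑ l, σs l ω * ξ l ω * c j l)) ^ 4 ∂P
        ≤ 3 * σstar ^ 2 / (b - a) ^ 2 * (∑ j, (v j) ^ 2) ^ 2) := by
  have hξ (l : Fin n) : HasLaw (ξ l) (gaussianReal 0 1) P := ⟨(hξmeas l).aemeasurable, hgauss l⟩
  have hσ (l : Fin n) : @Measurable Ω ℝ m0 _ (σs l) := (hσmeas l).mono hG le_rfl
  have hσξ : IndepFun (fun ω l ↦ σs l ω) (fun ω l ↦ ξ l ω) P := by
    rw [IndepFun_iff_Indep]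
    refine indep_of_indep_of_le_left (indep_of_indep_of_le_right hindepG.symm ?_) ?_
    · refine Measurable.comap_le
        (@measurable_pi_lambda _ _ _ (⨆ l, MeasurableSpace.comap (ξ l) Real.measurableSpace) _ _
          fun l ↦ ?_)
      exact (comap_measurable (ξ l)).mono
        (le_iSup (fun l ↦ MeasurableSpace.comap (ξ l) Real.measurableSpace) l) le_rfl
    · exact Measurable.comap_le (@measurable_pi_lambda _ _ _ G _ _ hσmeas)
  set V := ∑ j, v j ^ 2 with hV
  have hV0 : 0 ≤ V := Finset.sum_nonneg fun j _ ↦ sq_nonneg _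
  set w : Fin n → ℝ := fun l ↦ 1 / Real.sqrt n * ∑ j, v j * c j l with hw
  have hsum (ω : Ω) : ∑ j, v j * ((1 / Real.sqrt n) * ∑ l, σs l ω * ξ l ω * c j l) =
      ∑ l, w l * σs l ω * ξ l ω := by
    simp only [hw, Finset.mul_sum, Finset.sum_mul]
    rw [Finset.sum_comm]
    exact Finset.sum_congr rfl fun l _ ↦ Finset.sum_congr rfl fun j _ ↦ by ring
  have hw2 : ∑ l, w l ^ 2 = V / (b - a) := by
    have hn0 : (n : ℝ) ≠ 0 := by positivity
    simp only [hw, mul_pow, ← Finset.mul_sum, sum_sq_sum_mul_of_orthogonal horth, ← hV, div_pow,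
      Real.sq_sqrt n.cast_nonneg]
    field_simp
  set T := σstar / (b - a) * V with hT
  have hT0 : 0 ≤ T := by positivity
  have hbd : ∀ᵐ ω ∂P, ((∑ l, (w l * σs l ω) ^ 2).toNNReal : ℝ) ≤ T := by
    filter_upwards [ae_all_iff.2 hσbd] with ω hω
    rw [Real.coe_toNNReal _ (Finset.sum_nonneg fun l _ ↦ sq_nonneg _)]
    calc ∑ l, (w l * σs l ω) ^ 2 ≤ ∑ l, w l ^ 2 * σstar := by
          refine Finset.sum_le_sum fun l _ ↦ ?_
          rw [mul_pow]
          exact mul_le_mul_of_nonneg_left (hω l) (sq_nonneg _)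
      _ = T := by rw [← Finset.sum_mul, hw2, hT]; ring
  simp only [hsum]
  refine ⟨?_, ?_⟩
  · refine integral_pow_sum_mul_le hσ hξmeas hξ hiid hσξ w (by decide) hT0 ?_
    simpa only [integral_pow_two_gaussianReal_zero] using hbd
  · have hT4 : 3 * σstar ^ 2 / (b - a) ^ 2 * V ^ 2 = 3 * T ^ 2 := by
      rw [hT]; field_simp
    rw [hT4]
    refine integral_pow_sum_mul_le hσ hξmeas hξ hiid hσξ w (by decide) (by positivity) ?_
    filter_upwards [hbd] with ω hω
    rw [integral_pow_four_gaussianReal_zero]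
    gcongr
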